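/- Let F and F̃ be Borel probability measures on ℝ with finite first moments and equal means such that F̃ is a mean-preserving spread of F in the strict sense: ∫ h dF̃ ≥ ∫ h dF for every integrable convex h, with strict inequality for every integrable strictly convex h. Let ρ : ℝ × ℝ → ℝ be such that (i) for each distribution G ∈ {F, F̃} the function V_G(x) = ∫ ρ(x,π) dG(π) is differentiable and strictly concave on (0,∞) with V_G'(x) = ∫ ∂ρ/∂x(x,π) dG(π); (ii) for each x > 0 the map π ↦ ∂ρ/∂x(x,π) is strictly convex and integrable under both F and F̃; and (iii) each V_G attains an interior maximum at a unique R_L*(G) ∈ (0,∞) characterized by V_G'(R_L*(G)) = 0. Then R_L*(F̃) > R_L*(F). -/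

import Mathlib

open MeasureTheory

/-- Proposition 1 (Uncertainty-Induced Credit Tightening). If `F̃` is a strict
mean-preserving spread of `F`, the objectives `V_G(x) = ∫ ρ(x,π) dG(π)` are
differentiable and strictly concave on `(0,∞)` with derivative `∫ ρ'(x,π) dG(π)`,
the marginal payoff `π ↦ ρ'(x,π)` is strictly convex and integrable under both
measures, and each `V_G` has a unique interior maximizer `R_L*(G)` characterized by
the first-order condition, then `R_L*(F̃) > R_L*(F)`. -/
theorem mps_raises_loan_rate
    (F Ft : Measure ℝ) [IsProbabilityMeasure F] [IsProbabilityMeasure Ft]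
    (hmF : Integrable (fun π : ℝ => π) F) (hmFt : Integrable (fun π : ℝ => π) Ft)
    (hmean : ∫ π, π ∂Ft = ∫ π, π ∂F)
    (hMPS : ∀ h : ℝ → ℝ, ConvexOn ℝ Set.univ h →
      Integrable h F → Integrable h Ft → ∫ π, h π ∂F ≤ ∫ π, h π ∂Ft)
    (hMPSstrict : ∀ h : ℝ → ℝ, StrictConvexOn ℝ Set.univ h →
      Integrable h F → Integrable h Ft → ∫ π, h π ∂F < ∫ π, h π ∂Ft)
    (ρ ρ' : ℝ → ℝ → ℝ)
    -- (i) differentiability and strict concavity of the objectives on (0,∞)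
    (hderivF : ∀ x ∈ Set.Ioi (0:ℝ),
      HasDerivAt (fun y => ∫ π, ρ y π ∂F) (∫ π, ρ' x π ∂F) x)
    (hderivFt : ∀ x ∈ Set.Ioi (0:ℝ),
      HasDerivAt (fun y => ∫ π, ρ y π ∂Ft) (∫ π, ρ' x π ∂Ft) x)
    (hconcF : StrictConcaveOn ℝ (Set.Ioi (0:ℝ)) (fun y => ∫ π, ρ y π ∂F))
    (hconcFt : StrictConcaveOn ℝ (Set.Ioi (0:ℝ)) (fun y => ∫ π, ρ y π ∂Ft))
    -- (ii) the marginal payoff is strictly convex in π and integrable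
    (hconv : ∀ x ∈ Set.Ioi (0:ℝ), StrictConvexOn ℝ Set.univ (fun π => ρ' x π))
    (hintF : ∀ x ∈ Set.Ioi (0:ℝ), Integrable (fun π => ρ' x π) F)
    (hintFt : ∀ x ∈ Set.Ioi (0:ℝ), Integrable (fun π => ρ' x π) Ft)
    -- (iii) unique interior maximizers characterized by the first-order condition
    (RF RFt : ℝ) (hRF : RF ∈ Set.Ioi (0:ℝ)) (hRFt : RFt ∈ Set.Ioi (0:ℝ))
    (hmaxF : IsMaxOn (fun y => ∫ π, ρ y π ∂F) (Set.Ioi (0:ℝ)) RF)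
    (hmaxFt : IsMaxOn (fun y => ∫ π, ρ y π ∂Ft) (Set.Ioi (0:ℝ)) RFt)
    (hfocF : ∫ π, ρ' RF π ∂F = 0)
    (hfocFt : ∫ π, ρ' RFt π ∂Ft = 0)
    (huniqF : ∀ x ∈ Set.Ioi (0:ℝ), (∫ π, ρ' x π ∂F) = 0 → x = RF)
    (huniqFt : ∀ x ∈ Set.Ioi (0:ℝ), (∫ π, ρ' x π ∂Ft) = 0 → x = RFt) :
    RF < RFt := by
  have hpos : 0 < ∫ π, ρ' RF π ∂Ft :=
    hfocF ▸ hMPSstrict (fun π => ρ' RF π) (hconv RF hRF) (hintF RF hRF) (hintFt RF hRF)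
  by_contra! hle
  rcases hle.eq_or_lt with rfl | hlt
  · exact hpos.ne' hfocFt
  · have hslope := hconcFt.concaveOn.le_slope_of_hasDerivAt hRFt hRF hlt (hderivFt RF hRF)
    rw [slope_def_field] at hslope
    have hmax : ∫ π, ρ RF π ∂Ft ≤ ∫ π, ρ RFt π ∂Ft := hmaxFt hRF
    exact (hpos.trans_le hslope).not_ge
      (div_nonpos_of_nonpos_of_nonneg (sub_nonpos.2 hmax) (sub_nonneg.2 hle))
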